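/- For every cyclic system b of rank n ≥ 2, 0 ≤ CNTF(b) ≤ 1, and CNTF(b) = 0 if and only if b is noncontextual (i.e., an optimal defective coupling in the contextual-fraction program is a true probability measure exactly when the system is noncontextual). -/

import Mathlib

open Finset

/-- Cyclic predecessor `i ⊖ 1` on `Fin n`. -/
def fpred {n : ℕ} (i : Fin n) : Fin n := ⟨(i.val + (n - 1)) % n, Nat.mod_lt _ i.pos⟩

/-- Cyclic successor `i ⊕ 1` on `Fin n`. -/
def fsucc {n : ℕ} (i : Fin n) : Fin n := ⟨(i.val + 1) % n, Nat.mod_lt _ i.pos⟩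

/-- `b` specifies a cyclic system of rank `n`: each bunch distribution is
nonnegative and sums to one. -/
def IsCyclicSystem (n : ℕ) (b : Fin n → Bool → Bool → ℝ) : Prop :=
  (∀ i r r', 0 ≤ b i r r') ∧ ∀ i, (∑ r : Bool, ∑ r' : Bool, b i r r') = 1

/-- Marginal distribution of `R_i^i`. -/
def mFst {n : ℕ} (b : Fin n → Bool → Bool → ℝ) (i : Fin n) (r : Bool) : ℝ :=
  b i r false + b i r true

/-- Marginal distribution of `R_i^{i⊖1}`. -/
def mSnd {n : ℕ} (b : Fin n → Bool → Bool → ℝ) (i : Fin n) (r : Bool) : ℝ :=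
  b (fpred i) false r + b (fpred i) true r

/-- Multimaximal-coupling distribution of connection `i`:
joint distribution of `(T_i^i, T_i^{i⊖1})`. -/
noncomputable def mmc {n : ℕ} (b : Fin n → Bool → Bool → ℝ) (i : Fin n) : Bool → Bool → ℝ :=
  fun r r' =>
    match r, r' with
    | true, true => min (mFst b i true) (mSnd b i true)
    | false, false => min (mFst b i false) (mSnd b i false)
    | true, false => mFst b i true - min (mFst b i true) (mSnd b i true)
    | false, true => mSnd b i true - min (mFst b i true) (mSnd b i true)

/-- Bunch marginal of a signed quasi-coupling `y` at context `i`. -/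
def Bm {n : ℕ} (i : Fin n) (y : (Fin n → Bool × Bool) → ℝ) (r r' : Bool) : ℝ :=
  ∑ s : Fin n → Bool × Bool, if s i = (r, r') then y s else 0

/-- Connection marginal of a signed quasi-coupling `y` at content `i`. -/
def Cm {n : ℕ} (i : Fin n) (y : (Fin n → Bool × Bool) → ℝ) (r r' : Bool) : ℝ :=
  ∑ s : Fin n → Bool × Bool, if (s i).1 = r ∧ (s (fpred i)).2 = r' then y s else 0

/-- `y` is a feasible signed quasi-coupling for the system `b`. -/
def Feasible {n : ℕ} (b : Fin n → Bool → Bool → ℝ) (y : (Fin n → Bool × Bool) → ℝ) : Prop :=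
  ∀ i r r', Bm i y r r' = b i r r' ∧ Cm i y r r' = mmc b i r r'

/-- The quasi-coupling measure of contextuality. -/
noncomputable def CNT3 {n : ℕ} (b : Fin n → Bool → Bool → ℝ) : ℝ :=
  sInf {t : ℝ | ∃ y, Feasible b y ∧ t = ∑ s : Fin n → Bool × Bool, |y s|} - 1

/-- Constraints of the contextual-fraction linear program. -/
def CNTFConstraints {n : ℕ} (b : Fin n → Bool → Bool → ℝ)
    (z : (Fin n → Bool × Bool) → ℝ) : Prop :=
  (∀ s, 0 ≤ z s) ∧ ∀ i r r', Bm i z r r' ≤ b i r r' ∧ Cm i z r r' ≤ mmc b i r r'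

/-- The contextual fraction. -/
noncomputable def CNTF {n : ℕ} (b : Fin n → Bool → Bool → ℝ) : ℝ :=
  1 - sSup {t : ℝ | ∃ z, CNTFConstraints b z ∧ t = ∑ s : Fin n → Bool × Bool, z s}

/-- `b` is noncontextual iff it admits a nonnegative feasible coupling. -/
def Noncontextual {n : ℕ} (b : Fin n → Bool → Bool → ℝ) : Prop :=
  ∃ y, Feasible b y ∧ ∀ s, 0 ≤ y s

theorem sum_Bm {n : ℕ} (i : Fin n) (z : (Fin n → Bool × Bool) → ℝ) :
    ∑ r : Bool, ∑ r' : Bool, Bm i z r r' = ∑ s, z s := by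
  simp only [Bm, Fintype.sum_bool, ← Finset.sum_add_distrib]
  refine Finset.sum_congr rfl fun s _ => ?_
  rcases s i with ⟨_ | _, _ | _⟩ <;> simp

theorem sum_Cm {n : ℕ} (i : Fin n) (z : (Fin n → Bool × Bool) → ℝ) :
    ∑ r : Bool, ∑ r' : Bool, Cm i z r r' = ∑ s, z s := by
  simp only [Cm, Fintype.sum_bool, ← Finset.sum_add_distrib]
  refine Finset.sum_congr rfl fun s _ => ?_
  rcases (s i).1 with _ | _ <;> rcases (s (fpred i)).2 with _ | _ <;> simp

theorem mmc_nonneg {n : ℕ} {b : Fin n → Bool → Bool → ℝ} (hb : IsCyclicSystem n b)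
    (i : Fin n) (r r' : Bool) : 0 ≤ mmc b i r r' := by
  have hFst : ∀ r, 0 ≤ mFst b i r := fun r => add_nonneg (hb.1 _ _ _) (hb.1 _ _ _)
  have hSnd : ∀ r, 0 ≤ mSnd b i r := fun r => add_nonneg (hb.1 _ _ _) (hb.1 _ _ _)
  cases r <;> cases r' <;> simp [mmc, hFst, hSnd]

theorem sum_mmc {n : ℕ} {b : Fin n → Bool → Bool → ℝ} (hb : IsCyclicSystem n b) (i : Fin n) :
    ∑ r : Bool, ∑ r' : Bool, mmc b i r r' = 1 := by
  have h₁ := hb.2 i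
  have h₂ := hb.2 (fpred i)
  simp only [Fintype.sum_bool] at h₁ h₂
  simp only [Fintype.sum_bool, mmc, mFst, mSnd]
  rcases le_total (b i true false + b i true true)
    (b (fpred i) false true + b (fpred i) true true) with h | h
  · rw [min_eq_left h, min_eq_right (by linarith)]
    linarith
  · rw [min_eq_right h, min_eq_left (by linarith)]
    linarith

theorem eq_of_le_of_sum_bool_eq {f g : Bool → Bool → ℝ} (hle : ∀ r r', f r r' ≤ g r r')
    (hsum : ∑ r : Bool, ∑ r' : Bool, f r r' = ∑ r : Bool, ∑ r' : Bool, g r r')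
    (r r' : Bool) : f r r' = g r r' := by
  have h := (Finset.sum_eq_sum_iff_of_le
    fun r _ => Finset.sum_le_sum fun r' _ => hle r r').1 hsum r (Finset.mem_univ r)
  exact (Finset.sum_eq_sum_iff_of_le fun r' _ => hle r r').1 h r' (Finset.mem_univ r')

theorem CNTFConstraints.sum_le_one {n : ℕ} {b : Fin n → Bool → Bool → ℝ}
    (hb : IsCyclicSystem n b) (i : Fin n) {z : (Fin n → Bool × Bool) → ℝ}
    (hz : CNTFConstraints b z) : ∑ s, z s ≤ 1 := by
  rw [← sum_Bm i z, ← hb.2 i]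
  exact Finset.sum_le_sum fun r _ => Finset.sum_le_sum fun r' _ => (hz.2 i r r').1

theorem CNTFConstraints.feasible_of_sum_eq_one {n : ℕ} {b : Fin n → Bool → Bool → ℝ}
    (hb : IsCyclicSystem n b) {z : (Fin n → Bool × Bool) → ℝ}
    (hz : CNTFConstraints b z) (hsum : ∑ s, z s = 1) : Feasible b z := fun i r r' =>
  ⟨eq_of_le_of_sum_bool_eq (fun r r' => (hz.2 i r r').1)
      (by rw [sum_Bm, hsum, hb.2 i]) r r',
    eq_of_le_of_sum_bool_eq (fun r r' => (hz.2 i r r').2)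
      (by rw [sum_Cm, hsum, sum_mmc hb]) r r'⟩

theorem CNTFConstraints.zero {n : ℕ} {b : Fin n → Bool → Bool → ℝ}
    (hb : IsCyclicSystem n b) : CNTFConstraints b 0 :=
  ⟨fun _ => le_rfl, fun i r r' => by simp [Bm, Cm, hb.1, mmc_nonneg hb]⟩

theorem isCompact_setOf_CNTFConstraints {n : ℕ} {b : Fin n → Bool → Bool → ℝ}
    (hb : IsCyclicSystem n b) (i : Fin n) : IsCompact {z | CNTFConstraints b z} := by
  refine (isCompact_Icc (a := (0 : (Fin n → Bool × Bool) → ℝ)) (b := 1)).of_isClosed_subset ?_ ?_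
  · have hBm : ∀ (i : Fin n) (r r' : Bool), Continuous fun z => Bm i z r r' := fun i r r' =>
      continuous_finsetSum _ fun s _ => by split_ifs <;> fun_prop
    have hCm : ∀ (i : Fin n) (r r' : Bool), Continuous fun z => Cm i z r r' := fun i r r' =>
      continuous_finsetSum _ fun s _ => by split_ifs <;> fun_prop
    simp only [CNTFConstraints, Set.ofPred_and, Set.ofPred_forall]
    exact (isClosed_iInter fun s => isClosed_le continuous_const (continuous_apply s)).inter
      (isClosed_iInter fun i => isClosed_iInter fun r => isClosed_iInter fun r' =>
        (isClosed_le (hBm i r r') continuous_const).inter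
          (isClosed_le (hCm i r r') continuous_const))
  · exact fun z hz => ⟨hz.1, fun s =>
      (Finset.single_le_sum (fun t _ => hz.1 t) (Finset.mem_univ s)).trans (hz.sum_le_one hb i)⟩

/-- For every cyclic system of rank `n ≥ 2`, `0 ≤ CNTF(b) ≤ 1`, and `CNTF(b) = 0`
iff the system is noncontextual. -/
theorem cntf_nonneg_le_one_and_eq_zero_iff (n : ℕ) (hn : 2 ≤ n)
    (b : Fin n → Bool → Bool → ℝ) (hb : IsCyclicSystem n b) :
    0 ≤ CNTF b ∧ CNTF b ≤ 1 ∧ (CNTF b = 0 ↔ Noncontextual b) := by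
  let i : Fin n := ⟨0, by omega⟩
  obtain ⟨z, hz, hmax⟩ := (isCompact_setOf_CNTFConstraints hb i).exists_isMaxOn
    ⟨0, CNTFConstraints.zero hb⟩
    (f := fun z : (Fin n → Bool × Bool) → ℝ => ∑ s, z s) (by fun_prop)
  have hsup : CNTF b = 1 - ∑ s, z s := by
    have hgreatest : IsGreatest {t : ℝ | ∃ z, CNTFConstraints b z ∧ t = ∑ s, z s}
        (∑ s, z s) := by
      refine ⟨⟨z, hz, rfl⟩, ?_⟩
      rintro _ ⟨w, hw, rfl⟩
      exact hmax hw
    rw [CNTF, hgreatest.csSup_eq]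
  have hle : ∑ s, z s ≤ 1 := CNTFConstraints.sum_le_one hb i hz
  have hnonneg : 0 ≤ ∑ s, z s := Finset.sum_nonneg fun s _ => hz.1 s
  refine ⟨by linarith, by linarith, fun h => ?_, ?_⟩
  · exact ⟨z, CNTFConstraints.feasible_of_sum_eq_one hb hz (by linarith), hz.1⟩
  · rintro ⟨y, hy, hy_nonneg⟩
    have hmem : CNTFConstraints b y :=
      ⟨hy_nonneg, fun i r r' => ⟨(hy i r r').1.le, (hy i r r').2.le⟩⟩
    have hone : ∑ s, y s = 1 := by
      rw [← sum_Bm i y, ← hb.2 i]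
      simp only [(hy i _ _).1]
    have hyz : ∑ s, y s ≤ ∑ s, z s := hmax hmem
    linarith
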